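/- For real t ≠ 0 and x ∈ ℝⁿ, (πit)^{-n/2} ∫_{ℝⁿ} e^{i|x−y|²/t} η_{2M}(y) dy = π^{−n/2} (1+it)^{−n/2} e^{−|x|²/(1+it)} Σ_{j=0}^{M−1} (1+it)^{−j} L_j^{(n/2−1)}(|x|²/(1+it)). -/

import Mathlib

open MeasureTheory

/-- The generalized Laguerre polynomial
`L_k^{(γ)}(x) = ∑_{i=0}^k (-1)^i binom(k+γ, k-i) x^i / i!`. -/
noncomputable def genLaguerre (k : ℕ) (γ : ℂ) (x : ℂ) : ℂ :=
  ∑ i ∈ Finset.range (k + 1),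
    ((-1) ^ i / (Nat.factorial i : ℂ)) *
      ((∏ m ∈ Finset.range (k - i), (γ + i + 1 + m)) / (Nat.factorial (k - i) : ℂ)) * x ^ i

/-- The generating function `η_{2M}(x) = π^{-n/2} L_{M-1}^{(n/2)}(|x|²) e^{-|x|²}`. -/
noncomputable def etaFun (n M : ℕ) (x : EuclideanSpace ℝ (Fin n)) : ℂ :=
  (Real.pi : ℂ) ^ (-(n : ℂ) / 2) * genLaguerre (M - 1) ((n : ℂ) / 2) ((‖x‖ : ℂ) ^ 2) *
    Complex.exp (-(‖x‖ : ℂ) ^ 2)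

noncomputable section

def lagPoch (a : ℂ) (k : ℕ) : ℂ := ∏ m ∈ Finset.range k, (a + m)

lemma lagPoch_succ (a : ℂ) (k : ℕ) : lagPoch a (k+1) = lagPoch a k * (a + k) := by
  simp [lagPoch, Finset.prod_range_succ]

lemma lagPoch_succ' (a : ℂ) (k : ℕ) : lagPoch a (k+1) = a * lagPoch (a+1) k := by
  simp only [lagPoch, Finset.prod_range_succ']
  rw [mul_comm]
  congr 1
  · simp
  · apply Finset.prod_congr rfl; intros; push_cast; ring

lemma lagPoch_add (a : ℂ) (k l : ℕ) : lagPoch a (k+l) = lagPoch a k * lagPoch (a+k) l := by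
  simp only [lagPoch, Finset.prod_range_add]
  congr 1
  apply Finset.prod_congr rfl; intros; push_cast; ring

/-- coefficient -/
def lagC (k : ℕ) (γ : ℂ) (i : ℕ) : ℂ :=
  ((-1) ^ i / (Nat.factorial i : ℂ)) * (lagPoch (γ + i + 1) (k - i) / (Nat.factorial (k - i) : ℂ))

lemma genLaguerre_eq (k : ℕ) (γ x : ℂ) :
    genLaguerre k γ x = ∑ i ∈ Finset.range (k+1), lagC k γ i * x ^ i := rfl

lemma lagC_self (k : ℕ) (γ : ℂ) : lagC k γ k = (-1)^k / (Nat.factorial k : ℂ) := by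
  simp [lagC, lagPoch]

lemma genLaguerre_zero (γ x : ℂ) : genLaguerre 0 γ x = 1 := by
  simp [genLaguerre]

lemma lagC_hockey (N : ℕ) (γ : ℂ) (i : ℕ) (hi : i ≤ N) :
    lagC (N+1) (γ+1) i = lagC N (γ+1) i + lagC (N+1) γ i := by
  obtain ⟨d, rfl⟩ := Nat.exists_eq_add_of_le hi
  have e1 : i + d - i = d := by omega
  have e2 : i + d + 1 - i = d + 1 := by omega
  simp only [lagC, e1, e2]
  rw [lagPoch_succ, lagPoch_succ']
  have e3 : γ + i + 1 + 1 = γ + 1 + i + 1 := by ring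
  rw [e3, Nat.factorial_succ]
  have h1 : ((d.factorial : ℕ) : ℂ) ≠ 0 := by exact_mod_cast d.factorial_ne_zero
  have h2 : ((d : ℂ) + 1) ≠ 0 := by exact_mod_cast d.succ_ne_zero
  have h3 : ((i.factorial : ℕ) : ℂ) ≠ 0 := by exact_mod_cast i.factorial_ne_zero
  push_cast
  field_simp
  ring

lemma genLaguerre_hockey (N : ℕ) (γ x : ℂ) :
    genLaguerre N (γ+1) x = ∑ j ∈ Finset.range (N+1), genLaguerre j γ x := by
  induction N with
  | zero => simp [genLaguerre_zero]
  | succ N ih =>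
    rw [Finset.sum_range_succ, ← ih]
    simp only [genLaguerre_eq]
    rw [Finset.sum_range_succ _ (N+1), Finset.sum_range_succ _ (N+1), lagC_self, lagC_self,
      ← add_assoc, ← Finset.sum_add_distrib]
    congr 1
    apply Finset.sum_congr rfl
    intro i hi
    rw [lagC_hockey N γ i (by simpa [Nat.lt_succ_iff] using hi)]
    ring

lemma lagC_rec (k : ℕ) (γ : ℂ) (i : ℕ) (hi : i < k) :
    (k+1) * lagC (k+1) γ (i+1) = (γ+1+k+(i+1)) * lagC k γ (i+1) - lagC k γ i := by
  obtain ⟨d, rfl⟩ := Nat.exists_eq_add_of_le (Nat.succ_le_of_lt hi)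
  have e1 : i.succ + d + 1 - (i+1) = d+1 := by omega
  have e2 : i.succ + d - (i + 1) = d := by omega
  have e3 : i.succ + d - i = d+1 := by omega
  simp only [lagC, e1, e2, e3]
  have e4 : γ + i + 1 + 1 = γ + ((i+1:ℕ):ℂ) + 1 := by push_cast; ring
  rw [lagPoch_succ, lagPoch_succ' (γ + i + 1), e4, Nat.factorial_succ, Nat.factorial_succ]
  have h1 : ((d.factorial : ℕ) : ℂ) ≠ 0 := by exact_mod_cast d.factorial_ne_zero
  have h2 : ((d : ℂ) + 1) ≠ 0 := by exact_mod_cast d.succ_ne_zero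
  have h3 : ((i.factorial : ℕ) : ℂ) ≠ 0 := by exact_mod_cast i.factorial_ne_zero
  have h4 : ((i : ℂ) + 1) ≠ 0 := by exact_mod_cast i.succ_ne_zero
  generalize lagPoch (γ + ((i+1:ℕ):ℂ) + 1) d = Q
  rw [pow_succ]
  push_cast
  field_simp
  ring

/-- derivative -/
def lagD (k : ℕ) (γ x : ℂ) : ℂ := ∑ i ∈ Finset.range (k+1), lagC k γ i * (i * x ^ (i-1))

lemma hasDerivAt_genLaguerre (k : ℕ) (γ x : ℂ) :
    HasDerivAt (fun z => genLaguerre k γ z) (lagD k γ x) x := by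
  simp only [genLaguerre_eq, lagD]
  exact HasDerivAt.fun_sum fun i _ => (hasDerivAt_pow i x).const_mul _

lemma genLaguerre_rec (k : ℕ) (γ z : ℂ) :
    (k+1) * genLaguerre (k+1) γ z = (γ+1+k-z) * genLaguerre k γ z + z * lagD k γ z := by
  have hD : z * lagD k γ z = ∑ i ∈ Finset.range (k+1), (i:ℂ) * lagC k γ i * z ^ i := by
    rw [lagD, Finset.mul_sum]
    apply Finset.sum_congr rfl
    intro i _
    rcases i with _ | i
    · simp
    · simp [pow_succ]; ring
  have h1 : (γ+1+k-z) * genLaguerre k γ z + z * lagD k γ z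
      = (∑ i ∈ Finset.range (k+1), (γ+1+k+i) * lagC k γ i * z ^ i)
        - ∑ i ∈ Finset.range (k+1), lagC k γ i * z ^ (i+1) := by
    rw [hD, genLaguerre_eq, Finset.mul_sum, ← Finset.sum_add_distrib, ← Finset.sum_sub_distrib]
    apply Finset.sum_congr rfl
    intro i _
    ring
  rw [h1, Finset.sum_range_succ' _ k, Finset.sum_range_succ _ k, genLaguerre_eq,
    Finset.sum_range_succ, Finset.sum_range_succ' _ k, lagC_self, lagC_self]
  have h2 : ∑ i ∈ Finset.range k, (γ+1+k+((i+1:ℕ):ℂ)) * lagC k γ (i+1) * z ^ (i+1)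
      = (k+1) * ∑ i ∈ Finset.range k, lagC (k+1) γ (i+1) * z ^ (i+1)
        + ∑ i ∈ Finset.range k, lagC k γ i * z ^ (i+1) := by
    rw [Finset.mul_sum, ← Finset.sum_add_distrib]
    apply Finset.sum_congr rfl
    intro i hi
    have := lagC_rec k γ i (Finset.mem_range.1 hi)
    push_cast
    linear_combination (-z^(i+1)) * this
  rw [h2]
  have h3 : (k+1) * lagC (k+1) γ 0 = (γ+1+k) * lagC k γ 0 := by
    simp only [lagC, Nat.sub_zero]
    rw [lagPoch_succ, Nat.factorial_succ]
    have h1 : ((k.factorial : ℕ) : ℂ) ≠ 0 := by exact_mod_cast k.factorial_ne_zero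
    have h2 : ((k : ℂ) + 1) ≠ 0 := by exact_mod_cast k.succ_ne_zero
    push_cast
    field_simp
    ring
  have h4 : (k+1) * ((-1:ℂ)^(k+1) / ((k+1).factorial : ℂ)) = - ((-1)^k / (k.factorial : ℂ)) := by
    rw [Nat.factorial_succ]
    have h1 : ((k.factorial : ℕ) : ℂ) ≠ 0 := by exact_mod_cast k.factorial_ne_zero
    have h2 : ((k : ℂ) + 1) ≠ 0 := by exact_mod_cast k.succ_ne_zero
    push_cast
    field_simp
    ring
  push_cast
  linear_combination h3 + z^(k+1) * h4

lemma lagC_mul (j p q : ℕ) (γ : ℂ) (h : p + q ≤ j) :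
    lagC j γ (p+q) * ((p+q).factorial) * lagC (p+q) γ p
      = (-1)^(p+q) * lagC j γ p * ((j-p).choose q) := by
  obtain ⟨d, rfl⟩ := Nat.exists_eq_add_of_le h
  have e1 : p+q+d-(p+q) = d := by omega
  have e2 : p+q-p = q := by omega
  have e3 : p+q+d-p = q+d := by omega
  simp only [lagC, e1, e2, e3]
  have e4 : γ + ((p+q:ℕ):ℂ) + 1 = γ + p + 1 + q := by push_cast; ring
  rw [lagPoch_add, e4, Nat.choose_symm_add, Nat.add_choose, Nat.cast_div (Nat.factorial_mul_factorial_dvd_factorial_add q d)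
    (by exact_mod_cast mul_ne_zero q.factorial_ne_zero d.factorial_ne_zero)]
  have h1 (d : ℕ) : ((d.factorial : ℕ) : ℂ) ≠ 0 := by exact_mod_cast d.factorial_ne_zero
  have := h1 d
  have := h1 p
  have := h1 q
  have := h1 (p+q)
  have := h1 (q+d)
  push_cast
  field_simp

lemma lag_combo (j : ℕ) (γ u v z : ℂ) (h : u * z = - (v * (1 - u))) :
    ∑ i ∈ Finset.range (j+1), lagC j γ i * (i.factorial * u ^ i * genLaguerre i γ z)
      = (1-u)^j * genLaguerre j γ v := by
  have h0 : ∑ i ∈ Finset.range (j+1), lagC j γ i * (i.factorial * u ^ i * genLaguerre i γ z)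
    = ∑ i ∈ Finset.range (j+1), ∑ p ∈ Finset.range (i+1),
      lagC j γ i * (i.factorial * u ^ i * (lagC i γ p * z ^ p)) := by
    simp only [genLaguerre_eq, Finset.mul_sum]
  rw [h0, Finset.sum_comm' (t' := Finset.range (j+1)) (s' := fun p => Finset.Ico p (j+1))
    (by intro x y; simp only [Finset.mem_range, Finset.mem_Ico]; omega),
    genLaguerre_eq, Finset.mul_sum]
  apply Finset.sum_congr rfl
  intro p hp
  have hp' : p ≤ j := by simpa [Nat.lt_succ_iff] using hp
  rw [Finset.sum_Ico_eq_sum_range, show j + 1 - p = (j-p)+1 by omega]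
  have h1 : (1-u)^j = (1-u)^p * (-u+1)^(j-p) := by
    rw [show -u+1 = 1-u by ring, ← pow_add]; congr 1; omega
  rw [h1, add_pow, Finset.mul_sum, Finset.sum_mul]
  apply Finset.sum_congr rfl
  intro q hq
  have hq' : p + q ≤ j := by have := Finset.mem_range.1 hq; omega
  have h2 := lagC_mul j p q γ hq'
  have h3 : u^p * z^p = (-1)^p * (v^p * (1-u)^p) := by
    rw [← mul_pow, h, neg_pow, mul_pow]
  have h4 : ((-1:ℂ)^p) * (-1)^p = 1 := by rw [← mul_pow]; simp
  rw [neg_pow u q]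
  simp only [one_pow]
  calc _ = (lagC j γ (p+q) * ((p+q).factorial) * lagC (p+q) γ p) * (u^p*z^p) * u^q := by ring
    _ = _ := by rw [h2, h3, pow_add]; linear_combination (-1) ^ q * lagC j γ p * ((j - p).choose q) * (v ^ p * (1 - u) ^ p) * u ^ q * h4

lemma moment_aux {n : ℕ} (r : ℝ) (w : EuclideanSpace ℝ (Fin n)) (b : ℂ) (v : EuclideanSpace ℝ (Fin n)) :
    ‖Complex.exp (-b * (‖v‖:ℂ)^2 + (Complex.I * r) * ((inner ℝ w v : ℝ) : ℂ))‖
      = Real.exp (-b.re * ‖v‖^2) := by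
  rw [Complex.norm_exp]
  congr 1
  rw [← Complex.ofReal_pow]
  simp [-Complex.ofReal_pow]

lemma moment_integrable_real {n : ℕ} (k : ℕ) (δ : ℝ) (hδ : 0 < δ) :
    Integrable (fun v : EuclideanSpace ℝ (Fin n) => (‖v‖^2)^k * Real.exp (-δ * ‖v‖^2)) := by
  have h0 : Integrable (fun v : EuclideanSpace ℝ (Fin n) => Real.exp (-(δ/2) * ‖v‖^2)) := by
    have h := (GaussianFourier.integrable_cexp_neg_mul_sq_norm_add (V := EuclideanSpace ℝ (Fin n))
      (b := ((δ/2:ℝ):ℂ)) (by simpa using hδ) 0 0).norm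
    refine h.congr (Filter.Eventually.of_forall fun v => ?_)
    have := moment_aux 0 0 ((δ/2:ℝ):ℂ) v
    simpa using this
  refine (h0.const_mul (k.factorial / (δ/2)^k)).mono' (by fun_prop) ?_
  refine Filter.Eventually.of_forall fun v => ?_
  rw [Real.norm_of_nonneg (by positivity)]
  have h1 := Real.pow_div_factorial_le_exp (x := δ/2*‖v‖^2) (by positivity) k
  have h2 : Real.exp (-δ * ‖v‖^2) = Real.exp (-(δ/2) * ‖v‖^2) * Real.exp (-(δ/2) * ‖v‖^2) := by
    rw [← Real.exp_add]; congr 1; ring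
  have h3 : Real.exp (δ/2*‖v‖^2) * Real.exp (-(δ/2) * ‖v‖^2) = 1 := by
    rw [← Real.exp_add]; simp
  have hk : (0:ℝ) < k.factorial := by exact_mod_cast k.factorial_pos
  have h4 : (‖v‖^2)^k ≤ k.factorial / (δ/2)^k * Real.exp (δ/2*‖v‖^2) := by
    rw [div_le_iff₀ hk, mul_pow] at h1
    rw [div_mul_eq_mul_div, le_div_iff₀ (by positivity)]
    linarith
  calc (‖v‖^2)^k * Real.exp (-δ * ‖v‖^2)
      ≤ (k.factorial / (δ/2)^k * Real.exp (δ/2*‖v‖^2)) * Real.exp (-δ * ‖v‖^2) := by gcongr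
    _ = k.factorial / (δ/2)^k * Real.exp (-(δ/2) * ‖v‖^2) *
          (Real.exp (δ/2*‖v‖^2) * Real.exp (-(δ/2) * ‖v‖^2)) := by rw [h2]; ring
    _ = _ := by rw [h3, mul_one]

/-- integrand of the moments -/
def momF {n : ℕ} (r : ℝ) (w : EuclideanSpace ℝ (Fin n)) (k : ℕ) (b : ℂ)
    (v : EuclideanSpace ℝ (Fin n)) : ℂ :=
  ((‖v‖:ℂ)^2)^k * Complex.exp (-b * (‖v‖:ℂ)^2 + (Complex.I * r) * ((inner ℝ w v : ℝ) : ℂ))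

lemma momF_norm {n : ℕ} (r : ℝ) (w : EuclideanSpace ℝ (Fin n)) (k : ℕ) (b : ℂ)
    (v : EuclideanSpace ℝ (Fin n)) : ‖momF r w k b v‖ = (‖v‖^2)^k * Real.exp (-b.re * ‖v‖^2) := by
  rw [momF, norm_mul, moment_aux]
  simp

lemma momF_cont {n : ℕ} (r : ℝ) (w : EuclideanSpace ℝ (Fin n)) (k : ℕ) (b : ℂ) :
    Continuous (momF r w k b) := by
  unfold momF
  fun_prop

lemma momF_integrable {n : ℕ} (r : ℝ) (w : EuclideanSpace ℝ (Fin n)) (k : ℕ) (b : ℂ)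
    (hb : 0 < b.re) : Integrable (momF r w k b) := by
  refine (moment_integrable_real k b.re hb).mono' (momF_cont r w k b).aestronglyMeasurable ?_
  exact Filter.Eventually.of_forall fun v => (momF_norm r w k b v).le

lemma momF_deriv {n : ℕ} (r : ℝ) (w : EuclideanSpace ℝ (Fin n)) (k : ℕ) (b : ℂ)
    (hb : 0 < b.re) :
    HasDerivAt (fun b => ∫ v, momF r w k b v) (- ∫ v, momF r w (k+1) b v) b := by
  have hs : {z : ℂ | b.re/2 < z.re} ∈ nhds b :=
    (isOpen_lt continuous_const Complex.continuous_re).mem_nhds (by simp; linarith)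
  have := hasDerivAt_integral_of_dominated_loc_of_deriv_le (μ := volume)
    (F := fun b v => momF r w k b v) (F' := fun b v => - momF r w (k+1) b v)
    (bound := fun v => (‖v‖^2)^(k+1) * Real.exp (-(b.re/2) * ‖v‖^2)) hs
    (Filter.Eventually.of_forall fun z => (momF_cont r w k z).aestronglyMeasurable)
    (momF_integrable r w k b hb) (momF_cont r w (k+1) b).neg.aestronglyMeasurable
    (Filter.Eventually.of_forall fun v z hz => ?_)
    (moment_integrable_real (k+1) (b.re/2) (by linarith))
    (Filter.Eventually.of_forall fun v z hz => ?_)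
  · rw [← integral_neg]; exact this.2
  · rw [norm_neg, momF_norm]
    have : b.re/2 < z.re := hz
    gcongr
  · unfold momF
    have h := ((((hasDerivAt_id z).neg.mul_const ((‖v‖:ℂ)^2)).add_const
      ((Complex.I * r) * ((inner ℝ w v : ℝ) : ℂ))).cexp).const_mul (((‖v‖:ℂ)^2)^k)
    refine h.congr_deriv ?_
    simp only [Pi.neg_apply, id]
    ring

lemma moment_eq {n : ℕ} (r : ℝ) (w : EuclideanSpace ℝ (Fin n)) (k : ℕ) :
    ∀ b : ℂ, 0 < b.re → ∫ v, momF r w k b v =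
      ((Real.pi:ℂ)/b)^((n:ℂ)/2) * (k.factorial * (1/b)^k *
        genLaguerre k ((n:ℂ)/2-1) (((r*‖w‖)^2/4 : ℝ) / b)) * Complex.exp (-((((r*‖w‖)^2/4 : ℝ) : ℂ) / b)) := by
  induction k with
  | zero =>
    intro b hb
    have h := GaussianFourier.integral_cexp_neg_mul_sq_norm_add hb (Complex.I * r) w
    simp only [momF, pow_zero, one_mul]
    rw [h, genLaguerre_zero]
    simp only [finrank_euclideanSpace, Fintype.card_fin, Nat.factorial_zero]
    have hb0 : b ≠ 0 := by rintro rfl; simp at hb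
    have : (Complex.I * r)^2 * (‖w‖:ℂ)^2/(4*b) = -((((r*‖w‖)^2/4 : ℝ) : ℂ) / b) := by
      rw [mul_pow, Complex.I_sq]; push_cast; field_simp
    rw [this]
    simp
  | succ k ih =>
    intro b hb
    have hb0 : b ≠ 0 := by rintro rfl; simp at hb
    set ν : ℂ := (n:ℂ)/2
    set c : ℂ := (((r*‖w‖)^2/4 : ℝ) : ℂ)
    have h1 := momF_deriv r w k b hb
    have hs : ∀ᶠ z in nhds b, 0 < z.re :=
      (isOpen_lt continuous_const Complex.continuous_re).mem_nhds hb
    have hπ : 0 < ((Real.pi:ℂ)/b).re := by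
      rw [Complex.div_re]
      simp only [Complex.ofReal_re, Complex.ofReal_im, zero_mul, zero_div, add_zero]
      have := Real.pi_pos
      have := Complex.normSq_pos.2 hb0
      positivity
    have hπ0 : ((Real.pi:ℂ)/b) ≠ 0 := by intro h; rw [h] at hπ; simp at hπ
    have hinv : HasDerivAt (fun z : ℂ => 1/z) (-(1/b)^2) b := by
      simp only [one_div]
      exact (hasDerivAt_inv hb0).congr_deriv (by rw [inv_pow])
    have hpi : HasDerivAt (fun z : ℂ => (Real.pi:ℂ)/z) (Real.pi * (-(1/b)^2)) b := by
      simpa [div_eq_mul_inv] using hinv.const_mul (Real.pi:ℂ)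
    have hc : HasDerivAt (fun z : ℂ => c/z) (c * (-(1/b)^2)) b := by
      simpa [div_eq_mul_inv] using hinv.const_mul c
    have hA : HasDerivAt (fun z : ℂ => ((Real.pi:ℂ)/z)^ν) (-(ν/b) * ((Real.pi:ℂ)/b)^ν) b := by
      have := hpi.cpow_const (c := ν) (Or.inl hπ)
      refine this.congr_deriv ?_
      rw [Complex.cpow_sub _ _ hπ0, Complex.cpow_one]
      have : (Real.pi:ℂ) ≠ 0 := by exact_mod_cast Real.pi_ne_zero
      field_simp
    have hL : HasDerivAt (fun z : ℂ => genLaguerre k (ν-1) (c/z))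
        (lagD k (ν-1) (c/b) * (c * (-(1/b)^2))) b :=
      (hasDerivAt_genLaguerre k (ν-1) (c/b)).comp b hc
    have hE := hc.neg.cexp
    have hP : HasDerivAt (fun z : ℂ => (1/z)^k) (-(k/b) * (1/b)^k) b := by
      refine (hinv.pow k).congr_deriv ?_
      rcases k with _ | k
      · simp
      · simp only [Nat.add_sub_cancel, pow_succ]; push_cast; field_simp
    have h2 := (hA.mul ((hP.const_mul (k.factorial:ℂ)).mul hL)).mul hE
    have h3 := h1.unique (h2.congr_of_eventuallyEq (hs.mono fun z hz => ih z hz))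
    rw [← neg_inj, h3]
    have hrec := genLaguerre_rec k (ν-1) (c/b)
    have hfac : (((k+1).factorial:ℕ):ℂ) * (1/b)^(k+1) * genLaguerre (k+1) (ν-1) (c/b)
        = k.factorial * (1/b)^(k+1) * ((k+1) * genLaguerre (k+1) (ν-1) (c/b)) := by
      rw [Nat.factorial_succ]; push_cast; ring
    rw [hfac, hrec]
    simp only [Pi.mul_apply, Pi.neg_apply]
    generalize lagD k (ν-1) (c/b) = D
    generalize genLaguerre k (ν-1) (c/b) = L
    generalize Complex.exp (-(c/b)) = E
    generalize ((Real.pi:ℂ)/b)^ν = A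
    rw [pow_succ (1/b) k]
    generalize (1/b)^k = B
    field_simp
    ring

end

/-- `(πit)^{-n/2} ∫ e^{i|x-y|²/t} η_{2M}(y) dy
  = π^{-n/2} (1+it)^{-n/2} e^{-|x|²/(1+it)} ∑_{j=0}^{M-1} (1+it)^{-j} L_j^{(n/2-1)}(|x|²/(1+it))`. -/
theorem stmt10 {n : ℕ} (M : ℕ) (hM : 1 ≤ M) (t : ℝ) (ht : t ≠ 0)
    (x : EuclideanSpace ℝ (Fin n)) :
    (Real.pi * Complex.I * t) ^ (-(n : ℂ) / 2) *
        ∫ y : EuclideanSpace ℝ (Fin n),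
          Complex.exp (Complex.I * (‖x - y‖ : ℂ) ^ 2 / t) * etaFun n M y
      = (Real.pi : ℂ) ^ (-(n : ℂ) / 2) * (1 + Complex.I * t) ^ (-(n : ℂ) / 2) *
          Complex.exp (-(‖x‖ : ℂ) ^ 2 / (1 + Complex.I * t)) *
          ∑ j ∈ Finset.range M,
            (1 + Complex.I * t) ^ (-(j : ℂ)) *
              genLaguerre j ((n : ℂ) / 2 - 1) ((‖x‖ : ℂ) ^ 2 / (1 + Complex.I * t)) := by
  obtain ⟨N, rfl⟩ : ∃ N, M = N + 1 := ⟨M - 1, by omega⟩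
  have htc : (t:ℂ) ≠ 0 := by exact_mod_cast ht
  set ν : ℂ := (n:ℂ)/2 with hν
  have hneg : -(n:ℂ)/2 = -ν := by rw [hν]; ring
  set b : ℂ := 1 - Complex.I / t with hb
  set X : ℂ := (‖x‖:ℂ)^2 with hX
  set s : ℂ := Complex.I * t with hs
  have hs0 : s ≠ 0 := mul_ne_zero Complex.I_ne_zero htc
  have hbre : 0 < b.re := by
    have : b.re = 1 := by simp [hb, Complex.div_re]
    rw [this]; exact one_pos
  have hb0 : b ≠ 0 := by intro h; rw [h] at hbre; simp at hbre
  have h1sre : 0 < (1+s).re := by simp [hs]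
  have h1s0 : 1 + s ≠ 0 := by intro h; rw [h] at h1sre; simp at h1sre
  have hI := Complex.I_sq
  have hbs : b * s = 1 + s := by
    rw [hb, hs]; field_simp; linear_combination (-1:ℂ) * hI
  have hss : s^2 = -(t:ℂ)^2 := by rw [hs, mul_pow, hI]; ring
  -- integrand
  have hint : ∀ y : EuclideanSpace ℝ (Fin n),
      Complex.exp (Complex.I * (‖x - y‖ : ℂ) ^ 2 / t) * etaFun n (N+1) y
      = (Real.pi:ℂ)^(-ν) * Complex.exp (Complex.I * X / t) *
        ∑ j ∈ Finset.range (N+1), ∑ i ∈ Finset.range (j+1),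
          lagC j (ν-1) i * momF (-2/t) x i b y := by
    intro y
    have hsub : ((‖x - y‖:ℝ):ℂ)^2 = X - 2 * ((inner ℝ x y : ℝ):ℂ) + (‖y‖:ℂ)^2 := by
      have := norm_sub_sq_real x y
      rw [hX]
      exact_mod_cast congrArg (fun a : ℝ => (a:ℂ)) this
    have hexp : Complex.exp (Complex.I * (‖x - y‖ : ℂ) ^ 2 / t) * Complex.exp (-(‖y‖:ℂ)^2)
        = Complex.exp (Complex.I * X / t) *
          Complex.exp (-b * (‖y‖:ℂ)^2 + (Complex.I * ((-2/t:ℝ):ℂ)) * ((inner ℝ x y : ℝ) : ℂ)) := by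
      rw [← Complex.exp_add, ← Complex.exp_add]
      congr 1
      rw [hsub, hb]
      push_cast
      ring
    have hL : genLaguerre N ν ((‖y‖:ℂ)^2) = ∑ j ∈ Finset.range (N+1), ∑ i ∈ Finset.range (j+1),
          lagC j (ν-1) i * ((‖y‖:ℂ)^2)^i := by
      have := genLaguerre_hockey N (ν-1) ((‖y‖:ℂ)^2)
      rw [sub_add_cancel] at this
      rw [this]; rfl
    unfold etaFun
    rw [hneg, ← hν, Nat.add_sub_cancel, hL]
    calc _ = (Real.pi:ℂ)^(-ν) * (∑ j ∈ Finset.range (N+1), ∑ i ∈ Finset.range (j+1),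
          lagC j (ν-1) i * ((‖y‖:ℂ)^2)^i) *
          (Complex.exp (Complex.I * (‖x - y‖ : ℂ) ^ 2 / t) * Complex.exp (-(‖y‖:ℂ)^2)) := by ring
      _ = (Real.pi:ℂ)^(-ν) * Complex.exp (Complex.I * X / t) *
          ((∑ j ∈ Finset.range (N+1), ∑ i ∈ Finset.range (j+1),
          lagC j (ν-1) i * ((‖y‖:ℂ)^2)^i) *
          Complex.exp (-b * (‖y‖:ℂ)^2 + (Complex.I * ((-2/t:ℝ):ℂ)) * ((inner ℝ x y : ℝ) : ℂ))) := by
            rw [hexp]; ring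
      _ = _ := by
        congr 1
        simp only [Finset.sum_mul, momF, mul_assoc]
  have hii : ∀ j i, Integrable (fun y => lagC j (ν-1) i * momF (-2/t) x i b y) :=
    fun j i => (momF_integrable (-2/t) x i b hbre).const_mul _
  simp only [hint]
  rw [integral_const_mul, integral_finsetSum _ (fun j _ => integrable_finsetSum _ fun i _ => hii j i)]
  have hz : ((((-2/t*‖x‖)^2/4 : ℝ)) : ℂ) / b = X / (t^2 * b) := by
    rw [hX]; push_cast; field_simp; ring
  have hj : ∀ j, ∫ y, ∑ i ∈ Finset.range (j+1), lagC j (ν-1) i * momF (-2/t) x i b y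
      = ((Real.pi:ℂ)/b)^ν * Complex.exp (-(X / (t^2 * b))) *
        ((1+s)^(-(j:ℂ)) * genLaguerre j (ν-1) (X/(1+s))) := by
    intro j
    rw [integral_finsetSum _ (fun i _ => hii j i)]
    simp only [integral_const_mul, moment_eq _ x _ b hbre, hz]
    have hu : 1 - 1/b = 1/(1+s) := by
      rw [← hbs]; field_simp; linear_combination hbs
    have hu1 : (1+s)^(-(j:ℂ)) = (1-1/b)^j := by
      rw [hu, Complex.cpow_neg, Complex.cpow_natCast]; simp
    have hcombo := lag_combo j (ν-1) (1/b) (X/(1+s)) (X/(t^2*b)) (by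
      rw [hu]
      have ht2 : (t:ℂ)^2 = -s^2 := by rw [hss]; ring
      rw [ht2, ← hbs]
      field_simp)
    rw [hu1, ← hcombo, Finset.mul_sum]
    apply Finset.sum_congr rfl
    intro i _
    ring
  simp only [hj]
  rw [← Finset.mul_sum, hneg]
  have hexp : Complex.exp (Complex.I * X / t) * Complex.exp (-(X / (t^2 * b)))
      = Complex.exp (-X/(1+s)) := by
    rw [← Complex.exp_add]
    congr 1
    have ht2 : (t:ℂ)^2 = -s^2 := by rw [hss]; ring
    have h2 : Complex.I * X / t = - X / s := by
      rw [hs]; field_simp; rw [hI]; ring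
    rw [ht2, h2, ← hbs]
    field_simp
    linear_combination (-X) * hbs
  have hπb : 0 < ((Real.pi:ℂ)/b).re := by
    rw [Complex.div_re]
    simp only [Complex.ofReal_re, Complex.ofReal_im, zero_mul, zero_div, add_zero]
    have := Real.pi_pos
    have := Complex.normSq_pos.2 hb0
    positivity
  have hπb0 : ((Real.pi:ℂ)/b) ≠ 0 := by intro h; rw [h] at hπb; simp at hπb
  have hpow : ((Real.pi:ℂ) * Complex.I * t)^(-ν) = (1+s)^(-ν) * ((Real.pi:ℂ)/b)^(-ν) := by
    have h1 : (Real.pi:ℂ) * Complex.I * t = (1+s) * ((Real.pi:ℂ)/b) := by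
      rw [← hbs, hs]; field_simp
    have ha1 := abs_lt.1 (Complex.abs_arg_lt_pi_div_two_iff.2 (Or.inl h1sre))
    have ha2 := abs_lt.1 (Complex.abs_arg_lt_pi_div_two_iff.2 (Or.inl hπb))
    rw [h1, Complex.cpow_def_of_ne_zero (mul_ne_zero h1s0 hπb0), Complex.cpow_def_of_ne_zero h1s0,
      Complex.cpow_def_of_ne_zero hπb0, ← Complex.exp_add,
      Complex.log_mul h1s0 hπb0 ⟨by linarith [ha1.1, ha2.1], by linarith [ha1.2, ha2.2]⟩]
    ring_nf
  have hcancel : ((Real.pi:ℂ)/b)^(-ν) * ((Real.pi:ℂ)/b)^ν = 1 := by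
    rw [← Complex.cpow_add _ _ hπb0]; simp
  rw [hpow, ← hexp]
  generalize ∑ j ∈ Finset.range (N+1), (1+s)^(-(j:ℂ)) * genLaguerre j (ν-1) (X/(1+s)) = S
  linear_combination ((1+s)^(-ν) * (Real.pi:ℂ)^(-ν) * Complex.exp (Complex.I * X / t) *
    Complex.exp (-(X / (t^2 * b))) * S) * hcancel
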